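/- arXiv:math/0610275 — 2 statements merged into one kernel-verified Lean document; each statement's English description precedes it below -/
import Mathlib

section
/- Let r ≥ 1 be a fixed integer and p_1, ..., p_r be fixed distinct primes. Then uniformly for real x ≥ 3 and n = p_1^{a_1} ⋯ p_r^{a_r} with integers a_1, ..., a_r ≥ 1, the number L^{(e)}(x,n) of integers k ≤ x that are exponentially coprime to n satisfies L^{(e)}(x,n) = (1/r!) (∏_{i=1}^r φ(a_i)/(a_i log p_i)) (log x)^r + O((log x)^{r-1} ∑_{i=1}^r θ(a_i)), where the implied constant depends only on r and p_1, ..., p_r. -/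
/-- Two positive integers are *exponentially coprime* if they have the same prime
factors and the exponents of each common prime factor are coprime; `1` and `1` are
exponentially coprime, while `1` and `m > 1` are not. -/
def ExpCoprime (n m : ℕ) : Prop :=
  (n = 1 ∧ m = 1) ∨
    (1 < n ∧ 1 < m ∧ n.primeFactors = m.primeFactors ∧
      ∀ p ∈ n.primeFactors, Nat.Coprime (n.factorization p) (m.factorization p))

/-- `theta a` is the number of squarefree divisors of `a`. -/
def theta (a : ℕ) : ℕ := (a.divisors.filter Squarefree).card

theorem succ_mul_pow_le_pow_succ_sub (n : ℕ) {u : ℝ} (hu : 0 ≤ u) :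
    (n + 1) * u ^ n ≤ (u + 1) ^ (n + 1) - u ^ (n + 1) := by
  induction n with
  | zero => simp
  | succ n ih =>
    have h1 := mul_le_mul_of_nonneg_left ih hu
    have h2 : (0 : ℝ) ≤ (u + 1) ^ (n + 1) - u ^ (n + 1) := le_trans (by positivity) ih
    push_cast
    ring_nf at h1 h2 ⊢
    linarith

theorem pow_succ_sub_le_succ_mul_pow (n : ℕ) {u : ℝ} (hu : 0 ≤ u) :
    (u + 1) ^ (n + 1) - u ^ (n + 1) ≤ (n + 1) * (u + 1) ^ n := by
  induction n with
  | zero => simp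
  | succ n ih =>
    have h1 := mul_le_mul_of_nonneg_right ih (by linarith : 0 ≤ u + 1)
    have h2 : u ^ (n + 1) ≤ (u + 1) ^ (n + 1) := by gcongr; linarith
    push_cast
    ring_nf at h1 h2 ⊢
    linarith

/-- Comparison of `∑ (z - m) ^ n`, over the integers `1 ≤ m ≤ N = ⌊z⌋`, with its integral. -/
theorem sum_range_sub_pow_bounds (n N : ℕ) {z : ℝ} (h1 : (N : ℝ) ≤ z) (h2 : z < N + 1) :
    0 ≤ z ^ (n + 1) / (n + 1) - ∑ m ∈ Finset.range N, (z - (m + 1 : ℕ)) ^ n ∧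
      z ^ (n + 1) / (n + 1) - ∑ m ∈ Finset.range N, (z - (m + 1 : ℕ)) ^ n ≤ z ^ n := by
  induction N generalizing z with
  | zero =>
    have hz : 0 ≤ z := by simpa using h1
    have hz1 : z ≤ 1 := by simpa using h2.le
    refine ⟨by simp; positivity, ?_⟩
    simp only [Finset.range_zero, Finset.sum_empty, sub_zero]
    rw [div_le_iff₀ (by positivity), pow_succ]
    gcongr
    linarith [(Nat.cast_nonneg n : (0 : ℝ) ≤ n)]
  | succ N ih =>
    push_cast at h1 h2
    obtain ⟨ih1, ih2⟩ := ih (z := z - 1) (by linarith) (by linarith)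
    have hu : 0 ≤ z - 1 := by linarith [(Nat.cast_nonneg N : (0 : ℝ) ≤ N)]
    have l := succ_mul_pow_le_pow_succ_sub n hu
    have u := pow_succ_sub_le_succ_mul_pow n hu
    rw [sub_add_cancel] at l u
    have hn : (0 : ℝ) < n + 1 := by positivity
    have l' : (z - 1) ^ n ≤ z ^ (n + 1) / (n + 1) - (z - 1) ^ (n + 1) / (n + 1) := by
      rw [← sub_div, le_div_iff₀ hn]; linarith
    have u' : z ^ (n + 1) / (n + 1) - (z - 1) ^ (n + 1) / (n + 1) ≤ z ^ n := by
      rw [← sub_div, div_le_iff₀ hn]; linarith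
    rw [Finset.sum_range_succ']
    have e : ∀ m : ℕ, z - ((m + 1 + 1 : ℕ) : ℝ) = z - 1 - ((m + 1 : ℕ) : ℝ) := by
      intro m; push_cast; ring
    simp only [e, zero_add, Nat.cast_one]
    constructor <;> linarith

theorem abs_sum_sub_mul_pow_sub_le (n : ℕ) {y c : ℝ} (hy : 0 ≤ y) (hc : 0 < c) :
    |∑ m ∈ Finset.Icc 1 ⌊y / c⌋₊, (y - c * m) ^ n - y ^ (n + 1) / ((n + 1) * c)| ≤ y ^ n := by
  obtain ⟨h1, h2⟩ := sum_range_sub_pow_bounds n ⌊y / c⌋₊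
    (Nat.floor_le (div_nonneg hy hc.le)) (Nat.lt_floor_add_one _)
  have e : ∑ m ∈ Finset.Icc 1 ⌊y / c⌋₊, (y - c * m) ^ n =
      c ^ n * ∑ m ∈ Finset.range ⌊y / c⌋₊, (y / c - (m + 1 : ℕ)) ^ n := by
    rw [Finset.range_eq_Ico, Finset.sum_Ico_add' (fun m : ℕ => (y / c - m) ^ n), Finset.mul_sum]
    refine Finset.sum_congr (by ext; simp) fun m _ => ?_
    rw [← mul_pow]; congr 1; field_simp
  have hcn : 0 < c ^ n := by positivity
  have h1 := mul_le_mul_of_nonneg_left h1 hcn.le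
  have h2 := mul_le_mul_of_nonneg_left h2 hcn.le
  have e1 : c ^ n * ((y / c) ^ (n + 1) / (n + 1)) = y ^ (n + 1) / ((n + 1) * c) := by
    rw [div_pow]
    field_simp
    ring
  have e2 : c ^ n * (y / c) ^ n = y ^ n := by rw [← mul_pow]; congr 1; field_simp
  have hyn : 0 ≤ y ^ n := by positivity
  rw [mul_sub, e1, ← e] at h1 h2
  rw [e2] at h2
  rw [abs_le]
  constructor <;> linarith

open ArithmeticFunction in
theorem sum_divisors_moebius_eq (n : ℕ) :
    ∑ d ∈ n.divisors, (moebius d : ℝ) = if n = 1 then 1 else 0 := by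
  have h := congrArg (fun f : ArithmeticFunction ℤ => f n) coe_zeta_mul_moebius
  simp only [coe_zeta_mul_apply, one_apply] at h
  exact_mod_cast h

open ArithmeticFunction in
theorem totient_div_eq_sum_moebius_div (n : ℕ) (hn : 0 < n) :
    (Nat.totient n : ℝ) / n = ∑ d ∈ n.divisors, (moebius d : ℝ) / d := by
  have h := (sum_eq_iff_sum_mul_moebius_eq (R := ℝ) (f := fun n => (Nat.totient n : ℝ))
    (g := fun n => (n : ℝ))).1 (fun n _ => by exact_mod_cast Nat.sum_totient n) n hn
  rw [← h, Nat.sum_divisorsAntidiagonal (fun i j => (moebius i : ℝ) * (j : ℝ)), Finset.sum_div]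
  refine Finset.sum_congr rfl fun d hd => ?_
  obtain ⟨hd, -⟩ := Nat.mem_divisors.1 hd
  have : (d : ℝ) ≠ 0 := by
    have := Nat.pos_of_dvd_of_pos hd hn
    positivity
  have : (n : ℝ) ≠ 0 := by positivity
  rw [Nat.cast_div hd ‹_›]
  field_simp

open ArithmeticFunction in
theorem sum_abs_moebius_eq_theta (n : ℕ) :
    ∑ d ∈ n.divisors, |(moebius d : ℝ)| = theta n := by
  rw [theta, Finset.card_filter, Nat.cast_sum]
  refine Finset.sum_congr rfl fun d _ => ?_
  rw [← Int.cast_abs, abs_moebius]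
  split_ifs <;> simp

open ArithmeticFunction in
theorem sum_filter_coprime_eq_sum_moebius (a M : ℕ) (ha : 0 < a) (f : ℕ → ℝ) :
    ∑ b ∈ (Finset.Icc 1 M).filter (fun b => b.Coprime a), f b =
      ∑ d ∈ a.divisors, (moebius d : ℝ) * ∑ m ∈ Finset.Icc 1 (M / d), f (d * m) := by
  have key : ∀ d ∈ a.divisors, ∑ m ∈ Finset.Icc 1 (M / d), f (d * m) =
      ∑ b ∈ Finset.Icc 1 M, if d ∣ b then f b else 0 := by
    intro d hd
    have hd0 : 0 < d := Nat.pos_of_mem_divisors hd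
    rw [← Finset.sum_filter]
    refine Finset.sum_bij (fun m _ => d * m) ?_ ?_ ?_ ?_
    · intro m hm
      simp only [Finset.mem_Icc, Finset.mem_filter] at hm ⊢
      refine ⟨⟨Nat.mul_pos hd0 hm.1, ?_⟩, dvd_mul_right _ _⟩
      have := (Nat.le_div_iff_mul_le hd0).1 hm.2
      linarith [mul_comm d m]
    · intro m _ m' _ h
      exact Nat.eq_of_mul_eq_mul_left hd0 h
    · intro b hb
      simp only [Finset.mem_Icc, Finset.mem_filter] at hb
      obtain ⟨⟨h1, h2⟩, m, rfl⟩ := hb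
      refine ⟨m, ?_, rfl⟩
      rw [Finset.mem_Icc, Nat.le_div_iff_mul_le hd0, mul_comm]
      exact ⟨Nat.pos_of_mul_pos_left h1, h2⟩
    · intros; rfl
  rw [Finset.sum_congr (s₁ := a.divisors) rfl fun d hd => by rw [key d hd]]
  simp only [Finset.mul_sum]
  rw [Finset.sum_comm, Finset.sum_filter]
  refine Finset.sum_congr rfl fun b hb => ?_
  have hb : 1 ≤ b := (Finset.mem_Icc.1 hb).1
  have hg : 0 < Nat.gcd b a := Nat.gcd_pos_of_pos_left _ hb
  have e : (Nat.gcd b a).divisors = a.divisors.filter (· ∣ b) := by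
    ext d
    simp only [Nat.mem_divisors, Finset.mem_filter, Nat.dvd_gcd_iff]
    constructor
    · rintro ⟨⟨h1, h2⟩, -⟩; exact ⟨⟨h2, ha.ne'⟩, h1⟩
    · rintro ⟨⟨h1, h2⟩, h3⟩; exact ⟨⟨h3, h1⟩, hg.ne'⟩
  have s := sum_divisors_moebius_eq (Nat.gcd b a)
  rw [e, Finset.sum_filter] at s
  simp only [mul_ite, mul_zero]
  rw [show (∑ d ∈ a.divisors, if d ∣ b then (moebius d : ℝ) * f b else 0) =
    (∑ d ∈ a.divisors, if d ∣ b then (moebius d : ℝ) else 0) * f b by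
      rw [Finset.sum_mul]; exact Finset.sum_congr rfl fun _ _ => by split_ifs <;> simp, s]
  simp only [Nat.Coprime]
  split_ifs <;> simp

open ArithmeticFunction in
theorem abs_sum_coprime_sub_mul_pow_sub_le (n a : ℕ) (ha : 0 < a) {y c : ℝ} (hy : 0 ≤ y)
    (hc : 0 < c) :
    |∑ b ∈ (Finset.Icc 1 ⌊y / c⌋₊).filter (fun b => b.Coprime a), (y - c * b) ^ n -
        (Nat.totient a : ℝ) / (a * c) * (y ^ (n + 1) / (n + 1))| ≤ theta a * y ^ n := by
  have e : (Nat.totient a : ℝ) / (a * c) * (y ^ (n + 1) / (n + 1)) =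
      ∑ d ∈ a.divisors, (moebius d : ℝ) * (y ^ (n + 1) / ((n + 1) * (c * d))) := by
    rw [← div_div, totient_div_eq_sum_moebius_div a ha, Finset.sum_div, Finset.sum_mul]
    refine Finset.sum_congr rfl fun d hd => ?_
    have : 0 < d := Nat.pos_of_mem_divisors hd
    field_simp
  rw [sum_filter_coprime_eq_sum_moebius a _ ha (fun b => (y - c * b) ^ n), e,
    ← Finset.sum_sub_distrib, ← sum_abs_moebius_eq_theta, Finset.sum_mul]
  refine (Finset.abs_sum_le_sum_abs _ _).trans (Finset.sum_le_sum fun d hd => ?_)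
  have hd : 0 < d := Nat.pos_of_mem_divisors hd
  rw [← mul_sub, abs_mul]
  refine mul_le_mul_of_nonneg_left ?_ (abs_nonneg _)
  have := abs_sum_sub_mul_pow_sub_le n hy (c := c * d) (by positivity)
  rw [← div_div, Nat.floor_div_natCast] at this
  simpa only [Nat.cast_mul, mul_assoc] using this

/-- The positive integer points `b` with `∑ i, c i * b i ≤ y` and each `b i` prime to `a i`. -/
noncomputable def coprimePoints : (r : ℕ) → (Fin r → ℝ) → (Fin r → ℕ) → ℝ → Finset (Fin r → ℕ)
  | 0, _, _, _ => {Fin.elim0}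
  | r + 1, c, a, y =>
    ((Finset.Icc 1 ⌊y / c 0⌋₊).filter (fun b => b.Coprime (a 0))).biUnion fun b =>
      (coprimePoints r (Fin.tail c) (Fin.tail a) (y - c 0 * b)).image
        (Fin.cons (α := fun _ => ℕ) b)

theorem card_coprimePoints_succ (r : ℕ) (c : Fin (r + 1) → ℝ) (a : Fin (r + 1) → ℕ) (y : ℝ) :
    (coprimePoints (r + 1) c a y).card =
      ∑ b ∈ (Finset.Icc 1 ⌊y / c 0⌋₊).filter (fun b => b.Coprime (a 0)),
        (coprimePoints r (Fin.tail c) (Fin.tail a) (y - c 0 * b)).card := by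
  rw [coprimePoints, Finset.card_biUnion]
  · exact Finset.sum_congr rfl fun b _ =>
      Finset.card_image_of_injective _ (Fin.cons_right_injective (α := fun _ => ℕ) b)
  · intro b _ b' _ hb
    rw [Function.onFun, Finset.disjoint_left]
    intro v hv hv'
    simp only [Finset.mem_image] at hv hv'
    obtain ⟨w, -, rfl⟩ := hv
    obtain ⟨w', -, h⟩ := hv'
    exact hb (by simpa using (congrFun h 0).symm)

theorem mem_coprimePoints (r : ℕ) (c : Fin r → ℝ) (hc : ∀ i, 0 < c i) (a : Fin r → ℕ) {y : ℝ}
    (hy : 0 ≤ y) (b : Fin r → ℕ) :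
    b ∈ coprimePoints r c a y ↔
      (∀ i, 1 ≤ b i ∧ (b i).Coprime (a i)) ∧ ∑ i, c i * b i ≤ y := by
  induction r generalizing y with
  | zero => simp [coprimePoints, hy, eq_iff_true_of_subsingleton]
  | succ r ih =>
    simp only [coprimePoints, Finset.mem_biUnion, Finset.mem_filter, Finset.mem_Icc,
      Finset.mem_image]
    have hle : ∀ m : ℕ, m ≤ ⌊y / c 0⌋₊ ↔ c 0 * m ≤ y := fun m => by
      rw [Nat.le_floor_iff (div_nonneg hy (hc 0).le), le_div_iff₀ (hc 0), mul_comm]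
    constructor
    · rintro ⟨m, ⟨⟨h1, h2⟩, h3⟩, w, hw, rfl⟩
      rw [hle] at h2
      rw [ih (Fin.tail c) (fun i => hc i.succ) _ (by linarith)] at hw
      refine ⟨fun i => ?_, ?_⟩
      · refine Fin.cases ⟨h1, h3⟩ (fun j => ?_) i
        simpa [Fin.tail] using hw.1 j
      · rw [Fin.sum_univ_succ]
        have := hw.2
        simp only [Fin.cons_zero, Fin.cons_succ, Fin.tail] at this ⊢
        linarith
    · rintro ⟨h, hs⟩
      rw [Fin.sum_univ_succ] at hs
      have hpos : 0 ≤ ∑ i : Fin r, c i.succ * (b i.succ : ℝ) :=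
        Finset.sum_nonneg fun i _ => mul_nonneg (hc _).le (Nat.cast_nonneg _)
      have h0 : c 0 * b 0 ≤ y := by linarith
      refine ⟨b 0, ⟨⟨(h 0).1, (hle _).2 h0⟩, (h 0).2⟩, Fin.tail b, ?_, Fin.cons_self_tail b⟩
      rw [ih (Fin.tail c) (fun i => hc i.succ) _ (by linarith)]
      refine ⟨fun i => h i.succ, ?_⟩
      simp only [Fin.tail]
      linarith

theorem abs_card_coprimePoints_sub_le (r : ℕ) (c : Fin r → ℝ) (hc : ∀ i, 0 < c i) :
    ∃ C, 0 ≤ C ∧ ∀ y : ℝ, 0 ≤ y → ∀ a : Fin r → ℕ, (∀ i, 1 ≤ a i) →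
      |((coprimePoints r c a y).card : ℝ) - (1 / (r.factorial : ℝ)) *
          (∏ i, (Nat.totient (a i) : ℝ) / ((a i : ℝ) * c i)) * y ^ r| ≤
        C * (1 + y) ^ (r - 1) * ∑ i, (theta (a i) : ℝ) := by
  induction r with
  | zero => exact ⟨0, le_rfl, fun y _ a _ => by simp [coprimePoints]⟩
  | succ r ih =>
    obtain ⟨C, hC, ih⟩ := ih (Fin.tail c) (fun i => hc i.succ)
    have hc0 := hc 0
    have hB : 0 ≤ ∏ i, 1 / Fin.tail c i :=
      Finset.prod_nonneg fun i _ => one_div_nonneg.2 (hc i.succ).le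
    refine ⟨C / c 0 + ∏ i, 1 / Fin.tail c i, by positivity, fun y hy a ha => ?_⟩
    set B := ∏ i, 1 / Fin.tail c i
    set T := (Finset.Icc 1 ⌊y / c 0⌋₊).filter (fun b => b.Coprime (a 0)) with hT
    set Θ := ∑ i, (theta (Fin.tail a i) : ℝ) with hΘ
    set P := ∏ i, (Nat.totient (Fin.tail a i) : ℝ) / ((Fin.tail a i : ℝ) * Fin.tail c i) with hP
    set K := (1 / (r.factorial : ℝ)) * P with hK
    have hΘ0 : 0 ≤ Θ := Finset.sum_nonneg fun _ _ => Nat.cast_nonneg _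
    have hP0 : 0 ≤ P := Finset.prod_nonneg fun i _ =>
      div_nonneg (Nat.cast_nonneg _) (mul_nonneg (Nat.cast_nonneg _) (hc i.succ).le)
    have hPB : P ≤ B := by
      refine Finset.prod_le_prod (fun i _ =>
        div_nonneg (Nat.cast_nonneg _) (mul_nonneg (Nat.cast_nonneg _) (hc i.succ).le))
        fun i _ => ?_
      have h1 : (0 : ℝ) < Fin.tail a i := Nat.cast_pos.2 (ha i.succ)
      rw [← div_div]
      refine div_le_div_of_nonneg_right ?_ (hc i.succ).le
      rw [div_le_one h1]
      exact_mod_cast Nat.totient_le _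
    have hK0 : 0 ≤ K := by positivity
    have hKB : K ≤ B := by
      refine le_trans (mul_le_of_le_one_left hP0 ?_) hPB
      rw [div_le_one (by positivity)]
      exact_mod_cast r.factorial_pos
    have hmain := abs_sum_coprime_sub_mul_pow_sub_le r (a 0) (ha 0) hy hc0
    rw [← hT] at hmain
    have hcard : (T.card : ℝ) ≤ y / c 0 := by
      have h1 : T.card ≤ ⌊y / c 0⌋₊ := (Finset.card_filter_le _ _).trans (by simp)
      exact (Nat.cast_le.2 h1).trans (Nat.floor_le (by positivity))
    have herr : |∑ b ∈ T, ((coprimePoints r (Fin.tail c) (Fin.tail a) (y - c 0 * b)).card : ℝ) -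
        K * ∑ b ∈ T, (y - c 0 * b) ^ r| ≤ y / c 0 * (C * (1 + y) ^ (r - 1) * Θ) := by
      rw [Finset.mul_sum, ← Finset.sum_sub_distrib]
      refine (Finset.abs_sum_le_sum_abs _ _).trans ?_
      refine le_trans (Finset.sum_le_card_nsmul T _ (C * (1 + y) ^ (r - 1) * Θ) fun b hb => ?_) ?_
      · rw [hT, Finset.mem_filter, Finset.mem_Icc,
          Nat.le_floor_iff (div_nonneg hy hc0.le), le_div_iff₀ hc0] at hb
        have h0 : 0 ≤ y - c 0 * b := by linarith [hb.1.2, mul_comm (c 0) b]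
        have h1 : 0 ≤ c 0 * b := by positivity
        refine (ih _ h0 (Fin.tail a) fun i => ha i.succ).trans ?_
        gcongr
        linarith
      · rw [nsmul_eq_mul]
        gcongr
    have hyΘ : y * ((1 + y) ^ (r - 1) * Θ) ≤ (1 + y) ^ r * Θ := by
      cases r with
      | zero => simp [hΘ]
      | succ r =>
        rw [Nat.add_sub_cancel, pow_succ', mul_assoc]
        gcongr
        linarith
    rw [card_coprimePoints_succ, Nat.cast_sum, ← hT, Fin.prod_univ_succ, Fin.sum_univ_succ,
      Nat.add_sub_cancel]
    change |_ - _ * (_ * P) * _| ≤ _ * (_ + Θ)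
    have e : 1 / ((r + 1).factorial : ℝ) * ((Nat.totient (a 0) : ℝ) / (a 0 * c 0) * P) *
        y ^ (r + 1) = K * ((Nat.totient (a 0) : ℝ) / (a 0 * c 0) * (y ^ (r + 1) / (r + 1))) := by
      rw [Nat.factorial_succ, hK]; push_cast; field_simp
    rw [e]
    have hm2 := mul_le_mul_of_nonneg_left hmain hK0
    rw [← abs_of_nonneg hK0, ← abs_mul, abs_of_nonneg hK0, mul_sub] at hm2
    refine (abs_sub_le _ (K * ∑ b ∈ T, (y - c 0 * b) ^ r) _).trans
      ((add_le_add herr hm2).trans ?_)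
    have hθ0 : (0 : ℝ) ≤ theta (a 0) := Nat.cast_nonneg _
    clear_value K B Θ
    have hyr : y ^ r ≤ (1 + y) ^ r := by gcongr; linarith
    have b1 : y / c 0 * (C * (1 + y) ^ (r - 1) * Θ) ≤ C / c 0 * ((1 + y) ^ r * Θ) := by
      calc _ = C / c 0 * (y * ((1 + y) ^ (r - 1) * Θ)) := by ring
        _ ≤ _ := by gcongr
    have b2 : K * (theta (a 0) * y ^ r) ≤ B * (theta (a 0) * (1 + y) ^ r) := by gcongr
    have b3 : 0 ≤ C / c 0 * (theta (a 0) * (1 + y) ^ r) := by positivity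
    have b4 : 0 ≤ B * ((1 + y) ^ r * Θ) := by positivity
    linarith

theorem factorization_prod_pow_apply {r : ℕ} {p : Fin r → ℕ} (hp : ∀ i, (p i).Prime)
    (hinj : Function.Injective p) (b : Fin r → ℕ) (i : Fin r) :
    (∏ j, p j ^ b j).factorization (p i) = b i := by
  rw [Nat.factorization_prod fun j _ => pow_ne_zero _ (hp j).ne_zero, Finsupp.finsetSum_apply,
    Finset.sum_eq_single i]
  · simp [(hp i).factorization_pow]
  · intro j _ hj
    simp [(hp j).factorization_pow, hinj.ne hj]
  · simp

theorem primeFactors_prod_pow {r : ℕ} {p : Fin r → ℕ} (hp : ∀ i, (p i).Prime)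
    {b : Fin r → ℕ} (hb : ∀ i, 1 ≤ b i) :
    (∏ j, p j ^ b j).primeFactors = Finset.univ.image p := by
  ext q
  simp only [Nat.mem_primeFactors, Finset.mem_image, Finset.mem_univ, true_and]
  constructor
  · rintro ⟨hq, hd, -⟩
    obtain ⟨j, -, hj⟩ := (hq.prime.dvd_finsetProd_iff _).1 hd
    exact ⟨j, ((Nat.prime_dvd_prime_iff_eq hq (hp j)).1 (hq.dvd_of_dvd_pow hj)).symm⟩
  · rintro ⟨i, rfl⟩
    refine ⟨hp i, ?_, Finset.prod_ne_zero_iff.2 fun j _ => pow_ne_zero _ (hp j).ne_zero⟩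
    exact (dvd_pow_self _ (by have := hb i; omega)).trans
      (Finset.dvd_prod_of_mem (fun j => p j ^ b j) (Finset.mem_univ i))

theorem one_lt_prod_pow {r : ℕ} (hr : 1 ≤ r) {p : Fin r → ℕ} (hp : ∀ i, (p i).Prime)
    {b : Fin r → ℕ} (hb : ∀ i, 1 ≤ b i) : 1 < ∏ j, p j ^ b j := by
  have h : p ⟨0, hr⟩ ∈ (∏ j, p j ^ b j).primeFactors := by
    rw [primeFactors_prod_pow hp hb]; simp
  by_contra! h1
  interval_cases h2 : ∏ j, p j ^ b j <;> simp at h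

theorem expCoprime_prod_pow_iff {r : ℕ} (hr : 1 ≤ r) {p : Fin r → ℕ} (hp : ∀ i, (p i).Prime)
    (hinj : Function.Injective p) {a : Fin r → ℕ} (ha : ∀ i, 1 ≤ a i) (k : ℕ) :
    ExpCoprime k (∏ i, p i ^ a i) ↔
      ∃ b : Fin r → ℕ, (∀ i, 1 ≤ b i ∧ (b i).Coprime (a i)) ∧ ∏ i, p i ^ b i = k := by
  have hn := one_lt_prod_pow hr hp ha
  constructor
  · rintro (⟨-, h⟩ | ⟨hk, -, hpf, hcop⟩)
    · omega
    · rw [primeFactors_prod_pow hp ha] at hpf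
      have hmem : ∀ i, p i ∈ k.primeFactors := fun i => by rw [hpf]; simp
      refine ⟨fun i => k.factorization (p i), fun i => ⟨?_, ?_⟩, ?_⟩
      · exact (hp i).factorization_pos_of_dvd (by omega) (Nat.dvd_of_mem_primeFactors (hmem i))
      · have := hcop _ (hmem i)
        rwa [factorization_prod_pow_apply hp hinj] at this
      · conv_rhs => rw [← Nat.prod_factorization_pow_eq_self (by omega : k ≠ 0)]
        rw [Finsupp.prod, Nat.support_factorization, hpf,
          Finset.prod_image fun _ _ _ _ h => hinj h]
  · rintro ⟨b, hb, rfl⟩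
    refine Or.inr ⟨one_lt_prod_pow hr hp fun i => (hb i).1, hn, ?_, ?_⟩
    · rw [primeFactors_prod_pow hp ha, primeFactors_prod_pow hp fun i => (hb i).1]
    · rw [primeFactors_prod_pow hp fun i => (hb i).1]
      simp only [Finset.mem_image, Finset.mem_univ, true_and, forall_exists_index,
        forall_apply_eq_imp_iff]
      intro i
      rw [factorization_prod_pow_apply hp hinj, factorization_prod_pow_apply hp hinj]
      exact (hb i).2

theorem ncard_expCoprime_eq_card_coprimePoints {r : ℕ} (hr : 1 ≤ r) {p : Fin r → ℕ}
    (hp : ∀ i, (p i).Prime) (hinj : Function.Injective p) {a : Fin r → ℕ} (ha : ∀ i, 1 ≤ a i)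
    {x : ℝ} (hx : 1 ≤ x) :
    Set.ncard {k : ℕ | (k : ℝ) ≤ x ∧ ExpCoprime k (∏ i, p i ^ a i)} =
      (coprimePoints r (fun i => Real.log (p i)) a (Real.log x)).card := by
  have hlog : ∀ i, 0 < Real.log (p i) := fun i =>
    Real.log_pos (by exact_mod_cast (hp i).one_lt)
  have hiff : ∀ b : Fin r → ℕ, ((∏ i, p i ^ b i : ℕ) : ℝ) ≤ x ↔
      ∑ i, Real.log (p i) * b i ≤ Real.log x := by
    intro b
    have hpos : (0 : ℝ) < ((∏ i, p i ^ b i : ℕ) : ℝ) :=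
      Nat.cast_pos.2 (Finset.prod_pos fun i _ => pow_pos (hp i).pos _)
    rw [← Real.log_le_log_iff hpos (by linarith), Nat.cast_prod, Real.log_prod]
    · simp [Real.log_pow, mul_comm]
    · intro i _
      exact_mod_cast pow_ne_zero _ (hp i).ne_zero
  have himg : {k : ℕ | (k : ℝ) ≤ x ∧ ExpCoprime k (∏ i, p i ^ a i)} =
      (fun b : Fin r → ℕ => ∏ i, p i ^ b i) ''
        (coprimePoints r (fun i => Real.log (p i)) a (Real.log x) : Set (Fin r → ℕ)) := by
    ext k
    simp only [Set.mem_ofPred_eq, Set.mem_image, Finset.mem_coe,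
      mem_coprimePoints r _ hlog a (Real.log_nonneg hx), expCoprime_prod_pow_iff hr hp hinj ha]
    constructor
    · rintro ⟨hk, b, hb, rfl⟩
      exact ⟨b, ⟨hb, (hiff b).1 hk⟩, rfl⟩
    · rintro ⟨b, ⟨hb, hk⟩, rfl⟩
      exact ⟨(hiff b).2 hk, b, hb, rfl⟩
  rw [himg, Set.ncard_image_of_injective _ fun b b' h => ?_, Set.ncard_coe_finset]
  funext i
  rw [← factorization_prod_pow_apply hp hinj b i, ← factorization_prod_pow_apply hp hinj b' i]
  exact congrArg (fun k : ℕ => k.factorization (p i)) h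

/-- **Theorem 1.** For fixed `r ≥ 1` and fixed distinct primes `p 1, ..., p r`,
uniformly for real `x ≥ 3` and `n = ∏ i, p i ^ a i` with `a i ≥ 1`, the number
`L^{(e)}(x,n)` of integers `k ≤ x` exponentially coprime to `n` equals
`(1/r!) (∏ i, φ(a i)/(a i log p i)) (log x)^r + O((log x)^{r-1} ∑ i, θ(a i))`,
the implied constant depending only on `r` and `p`. -/
theorem expCoprime_count_asymptotic
    (r : ℕ) (hr : 1 ≤ r) (p : Fin r → ℕ)
    (hp : ∀ i, (p i).Prime) (hinj : Function.Injective p) :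
    ∃ C > 0, ∀ x : ℝ, 3 ≤ x → ∀ a : Fin r → ℕ, (∀ i, 1 ≤ a i) →
      |(Set.ncard {k : ℕ | (k : ℝ) ≤ x ∧ ExpCoprime k (∏ i, p i ^ a i)} : ℝ) -
          (1 / (r.factorial : ℝ)) *
            (∏ i, (Nat.totient (a i) : ℝ) / ((a i : ℝ) * Real.log (p i))) *
            Real.log x ^ r| ≤
        C * Real.log x ^ (r - 1) * ∑ i, (theta (a i) : ℝ) := by
  obtain ⟨C, hC, h⟩ := abs_card_coprimePoints_sub_le r (fun i => Real.log (p i)) fun i =>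
    Real.log_pos (by exact_mod_cast (hp i).one_lt)
  refine ⟨C * 2 ^ (r - 1) + 1, by positivity, fun x hx a ha => ?_⟩
  have hlog : 1 ≤ Real.log x := by
    rw [Real.le_log_iff_exp_le (by linarith)]
    linarith [Real.exp_one_lt_d9]
  rw [ncard_expCoprime_eq_card_coprimePoints hr hp hinj ha (by linarith)]
  refine (h _ (by linarith) a ha).trans ?_
  refine mul_le_mul_of_nonneg_right ?_ (Finset.sum_nonneg fun _ _ => Nat.cast_nonneg _)
  calc C * (1 + Real.log x) ^ (r - 1) ≤ C * (2 * Real.log x) ^ (r - 1) := by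
        gcongr
        linarith
    _ = C * 2 ^ (r - 1) * Real.log x ^ (r - 1) := by rw [mul_pow]; ring
    _ ≤ _ := by
        gcongr
        linarith
end

section
/- Let r ≥ 1 be a fixed integer and p_1, ..., p_r be fixed distinct primes. Then the asymptotic density of pairs of exponentially coprime integers having prime divisors exactly p_1, ..., p_r equals (ζ(2))^{-r}; that is, lim_{x→∞} P^{(e)}(p_1,...,p_r;x) · (N(p_1,...,p_r;x))^{-2} = (ζ(2))^{-r}. -/
open Filter

/-- The points with positive integer coordinates in the simplex `∑ i, u i * t i ≤ T`. -/
noncomputable def simplexPoints {ι : Type*} [Fintype ι] [DecidableEq ι] (u : ι → ℝ) (T : ℝ) :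
    Finset (ι → ℕ) :=
  (Fintype.piFinset fun i => Finset.Icc 1 ⌊T / u i⌋₊).filter fun c => ∑ i, u i * c i ≤ T

/-- The simplex of points with `0 < t i` for all `i` and `∑ i, u i * t i ≤ 1`. -/
def weightedSimplex {ι : Type*} [Fintype ι] (u : ι → ℝ) : Set (ι → ℝ) :=
  {t | (∀ i, 0 < t i) ∧ ∑ i, u i * t i ≤ 1}

section
variable {ι : Type*} [Fintype ι]

lemma mem_simplexPoints [DecidableEq ι] {u : ι → ℝ} (hu : ∀ i, 0 < u i) {T : ℝ} {c : ι → ℕ} :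
    c ∈ simplexPoints u T ↔ (∀ i, 0 < c i) ∧ ∑ i, u i * c i ≤ T := by
  simp only [simplexPoints, Finset.mem_filter, Fintype.mem_piFinset, Finset.mem_Icc]
  refine ⟨fun h => ⟨fun i => (h.1 i).1, h.2⟩, fun h => ⟨fun i => ⟨h.1 i, ?_⟩, h.2⟩⟩
  rw [Nat.le_floor_iff' (h.1 i).ne', le_div_iff₀ (hu i), mul_comm]
  refine le_trans ?_ h.2
  exact Finset.single_le_sum (f := fun i => u i * (c i : ℝ))
    (fun j _ => by have := hu j; positivity) (Finset.mem_univ i)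

lemma card_simplexPoints_le [DecidableEq ι] {u : ι → ℝ} (hu : ∀ i, 0 < u i) {T : ℝ} (hT : 0 ≤ T) :
    ((simplexPoints u T).card : ℝ) ≤ ∏ i, (T / u i) := by
  calc ((simplexPoints u T).card : ℝ)
      ≤ ((Fintype.piFinset fun i => Finset.Icc 1 ⌊T / u i⌋₊).card : ℝ) := by
        exact_mod_cast Finset.card_filter_le _ _
    _ = ∏ i, (⌊T / u i⌋₊ : ℝ) := by simp
    _ ≤ ∏ i, (T / u i) := by
        gcongr with i
        exact Nat.floor_le (div_nonneg hT (hu i).le)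

lemma weightedSimplex_subset {u : ι → ℝ} (hu : ∀ i, 0 < u i) :
    weightedSimplex u ⊆ Set.Icc 0 (fun i => 1 / u i) := by
  rintro t ⟨h0, h1⟩
  refine ⟨fun i => (h0 i).le, fun i => ?_⟩
  rw [le_div_iff₀ (hu i), mul_comm]
  refine le_trans ?_ h1
  exact Finset.single_le_sum (f := fun i => u i * t i)
    (fun j _ => mul_nonneg (hu j).le (h0 j).le) (Finset.mem_univ i)

lemma convex_weightedSimplex (u : ι → ℝ) : Convex ℝ (weightedSimplex u) := by
  rintro s ⟨hs, hs'⟩ t ⟨ht, ht'⟩ a b ha hb hab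
  refine ⟨fun i => (convex_Ioi (0 : ℝ)) (hs i) (ht i) ha hb hab, ?_⟩
  have : ∑ i, u i * (a • s + b • t) i = a * ∑ i, u i * s i + b * ∑ i, u i * t i := by
    simp only [Finset.mul_sum, ← Finset.sum_add_distrib]
    refine Finset.sum_congr rfl fun i _ => ?_
    simp; ring
  rw [this]
  nlinarith

lemma measurableSet_weightedSimplex (u : ι → ℝ) : MeasurableSet (weightedSimplex u) := by
  unfold weightedSimplex
  measurability

open Pointwise in
lemma card_simplexPoints_eq [DecidableEq ι] {u : ι → ℝ} (hu : ∀ i, 0 < u i) {T : ℝ} (hT : 0 < T) :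
    (simplexPoints u T).card = Nat.card ↑(weightedSimplex u ∩
      T⁻¹ • (Submodule.span ℤ (Set.range (Pi.basisFun ℝ ι)) : Set (ι → ℝ))) := by
  have hinj : Function.Injective fun (c : ι → ℕ) (i : ι) => T⁻¹ * (c i : ℝ) := fun a b h => by
    ext i
    have := congrFun h i
    simpa [hT.ne'] using this
  have hsum : ∀ c : ι → ℕ, ∑ i, u i * (T⁻¹ * (c i : ℝ)) ≤ 1 ↔ ∑ i, u i * (c i : ℝ) ≤ T := fun c => by
    have : ∑ i, u i * (T⁻¹ * (c i : ℝ)) = (∑ i, u i * (c i : ℝ)) / T := by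
      rw [Finset.sum_div]
      exact Finset.sum_congr rfl fun i _ => by field_simp
    rw [this, div_le_one hT]
  rw [Nat.card_coe_set_eq, ← Set.ncard_coe_finset, ← Set.ncard_image_of_injective _ hinj]
  congr 1
  ext x
  rw [Set.mem_inter_iff, Set.mem_inv_smul_set_iff₀ hT.ne', SetLike.mem_coe,
    Module.Basis.mem_span_iff_repr_mem]
  simp only [Set.mem_image, SetLike.mem_coe, mem_simplexPoints hu, Pi.basisFun_repr,
    Pi.smul_apply, smul_eq_mul, Set.mem_range, algebraMap_int_eq, eq_intCast]
  constructor
  · rintro ⟨c, ⟨hc0, hc⟩, rfl⟩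
    refine ⟨⟨fun i => ?_, (hsum c).2 hc⟩, fun i => ⟨c i, ?_⟩⟩
    · have := hc0 i
      positivity
    · simp [hT.ne']
  · rintro ⟨⟨hx0, hx⟩, hz⟩
    choose z hz using hz
    have hz0 : ∀ i, 0 < z i := fun i => by
      have h : 0 < T * x i := mul_pos hT (hx0 i)
      rw [← hz i] at h
      exact_mod_cast h
    have hcast : ∀ i, ((z i).toNat : ℝ) = T * x i := fun i => by
      rw [← hz i]
      exact_mod_cast Int.toNat_of_nonneg (hz0 i).le
    have hx' : (fun i => T⁻¹ * ((z i).toNat : ℝ)) = x := by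
      ext i
      rw [hcast, inv_mul_cancel_left₀ hT.ne']
    refine ⟨fun i => (z i).toNat, ⟨fun i => Int.pos_iff_toNat_pos.1 (hz0 i), ?_⟩, hx'⟩
    rw [← hsum]
    simpa only [← hx'] using hx

open Pointwise in
lemma tendsto_card_simplexPoints [DecidableEq ι] {u : ι → ℝ} (hu : ∀ i, 0 < u i) :
    Tendsto (fun T : ℝ => ((simplexPoints u T).card : ℝ) / T ^ Fintype.card ι) atTop
      (nhds (MeasureTheory.volume.real (weightedSimplex u))) := by
  have := tendsto_card_div_pow_atTop_volume' (weightedSimplex u)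
    ((Metric.isBounded_Icc _ _).subset (weightedSimplex_subset hu))
    (measurableSet_weightedSimplex u) ((convex_weightedSimplex u).addHaar_frontier _) (by
      rintro x y hx hxy _ ⟨t, ht, rfl⟩
      refine ⟨(x / y) • t, ⟨fun i => ?_, ?_⟩, ?_⟩
      · have := ht.1 i
        have : 0 < y := hx.trans_le hxy
        simp only [Pi.smul_apply, smul_eq_mul]; positivity
      · have hy : 0 < y := hx.trans_le hxy
        have : ∑ i, u i * ((x / y) • t) i = x / y * ∑ i, u i * t i := by
          rw [Finset.mul_sum]
          refine Finset.sum_congr rfl fun i _ => ?_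
          simp; ring
        rw [this]
        have h1 : x / y ≤ 1 := (div_le_one hy).2 hxy
        have h2 : 0 ≤ x / y := by positivity
        exact (mul_le_mul_of_nonneg_left ht.2 h2).trans (by simpa using h1)
      · have hy : 0 < y := hx.trans_le hxy
        simp only [smul_smul]
        rw [mul_div_cancel₀ _ hy.ne'])
  refine this.congr' ?_
  filter_upwards [eventually_gt_atTop 0] with T hT
  rw [card_simplexPoints_eq hu hT]

lemma volume_weightedSimplex_mul {u d : ι → ℝ} (hd : ∀ i, 0 < d i) :
    MeasureTheory.volume.real (weightedSimplex fun i => u i * d i) =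
      (∏ i, d i)⁻¹ * MeasureTheory.volume.real (weightedSimplex u) := by
  classical
  have hdet : LinearMap.det (Matrix.toLin' (Matrix.diagonal d)) = ∏ i, d i := by
    simp [LinearMap.det_toLin']
  have hpos : 0 < ∏ i, d i := Finset.prod_pos fun i _ => hd i
  have := MeasureTheory.Measure.addHaar_preimage_linearMap MeasureTheory.volume
    (f := Matrix.toLin' (Matrix.diagonal d)) (by rw [hdet]; exact hpos.ne') (weightedSimplex u)
  have hpre : (Matrix.toLin' (Matrix.diagonal d)) ⁻¹' (weightedSimplex u) =
      weightedSimplex fun i => u i * d i := by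
    ext t
    simp [weightedSimplex, Matrix.mulVec_diagonal, hd, mul_assoc]
  rw [hpre, hdet] at this
  rw [MeasureTheory.measureReal_def, this, ENNReal.toReal_mul, ENNReal.toReal_ofReal (abs_nonneg _),
    abs_of_pos (inv_pos.2 hpos), MeasureTheory.measureReal_def]

lemma volume_weightedSimplex_pos {u : ι → ℝ} (hu : ∀ i, 0 < u i) :
    0 < MeasureTheory.volume.real (weightedSimplex u) := by
  have hfin : MeasureTheory.volume (weightedSimplex u) ≠ ⊤ :=
    ((Metric.isBounded_Icc _ _).subset (weightedSimplex_subset hu)).measure_lt_top.ne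
  refine ENNReal.toReal_pos ?_ hfin
  set U : Set (ι → ℝ) := {t | (∀ i, 0 < t i) ∧ ∑ i, u i * t i < 1} with hU
  have hsub : U ⊆ weightedSimplex u := fun t ht => ⟨ht.1, ht.2.le⟩
  have hopen : IsOpen U := by
    rw [hU, Set.ofPred_and]
    refine IsOpen.inter ?_ (isOpen_lt (by fun_prop) continuous_const)
    rw [Set.ofPred_forall]
    exact isOpen_iInter_of_finite fun i => isOpen_lt continuous_const (continuous_apply i)
  have hne : U.Nonempty := by
    refine ⟨fun i => (u i * (Fintype.card ι + 1))⁻¹, fun i => ?_, ?_⟩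
    · have := hu i
      positivity
    · have : ∀ i, u i * (u i * ((Fintype.card ι : ℝ) + 1))⁻¹ = ((Fintype.card ι : ℝ) + 1)⁻¹ :=
        fun i => by have := (hu i).ne'; field_simp
      simp only [this, Finset.sum_const, Finset.card_univ, nsmul_eq_mul]
      rw [← div_eq_mul_inv, div_lt_one (by positivity)]
      linarith
  exact ((hopen.measure_pos _ hne).trans_le (MeasureTheory.measure_mono hsub)).ne'

end

lemma hasSum_prod_pi {α : Type*} {f : α → ℝ} {s : ℝ} (hf : HasSum f s) (r : ℕ) :
    HasSum (fun d : Fin r → α => ∏ i, f (d i)) (s ^ r) := by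
  induction r with
  | zero => simp [hasSum_unique]
  | succ r ih =>
    have hsum : Summable fun x : α × (Fin r → α) => f x.1 * ∏ i, f (x.2 i) :=
      summable_mul_of_summable_norm (f := f) (g := fun d : Fin r → α => ∏ i, f (d i))
        hf.summable.norm ih.summable.norm
    have h := hf.mul ih hsum
    rw [pow_succ', ← (Fin.consEquiv fun _ : Fin (r + 1) => α).hasSum_iff]
    refine h.congr_fun fun x => ?_
    simp [Fin.consEquiv, Fin.prod_univ_succ]

open ArithmeticFunction in
lemma hasSum_moebius_div_sq :
    HasSum (fun n : ℕ => (ArithmeticFunction.moebius n : ℝ) / (n : ℝ) ^ 2)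
      (Real.pi ^ 2 / 6)⁻¹ := by
  have h2 : 1 < (2 : ℂ).re := by simp
  have hs := (LSeriesSummable_moebius_iff.2 h2).LSeriesHasSum
  have h1 := LSeries_one_mul_Lseries_moebius h2
  rw [LSeries_one_eq_riemannZeta h2, riemannZeta_two] at h1
  rw [eq_inv_of_mul_eq_one_right h1] at hs
  rw [← Complex.hasSum_ofReal]
  rw [LSeriesHasSum] at hs
  convert hs using 1
  · ext n
    rcases eq_or_ne n 0 with rfl | hn
    · simp
    · simp [LSeries.term_of_ne_zero hn]
  · push_cast; rfl

lemma sum_moebius_common_divisors {a b M : ℕ} (ha : 0 < a) (haM : a ≤ M) :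
    ∑ d ∈ Finset.Icc 1 M, (if d ∣ a ∧ d ∣ b then (ArithmeticFunction.moebius d : ℝ) else 0) =
      if Nat.Coprime a b then 1 else 0 := by
  have h := congrArg (fun f : ArithmeticFunction ℤ => f (a.gcd b))
    ArithmeticFunction.moebius_mul_coe_zeta
  have hg : 0 < a.gcd b := Nat.gcd_pos_of_pos_left _ ha
  simp only [ArithmeticFunction.coe_mul_zeta_apply,
    ArithmeticFunction.one_apply] at h
  rw [← Finset.sum_filter]
  have : (Finset.Icc 1 M).filter (fun d => d ∣ a ∧ d ∣ b) = (a.gcd b).divisors := by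
    ext d
    simp only [Finset.mem_filter, Finset.mem_Icc, Nat.mem_divisors, Nat.dvd_gcd_iff]
    constructor
    · rintro ⟨-, h⟩; exact ⟨h, hg.ne'⟩
    · rintro ⟨h, -⟩
      exact ⟨⟨Nat.pos_of_dvd_of_pos h.1 ha, (Nat.le_of_dvd ha h.1).trans haM⟩, h⟩
  rw [this]
  simp only [Nat.coprime_iff_gcd_eq_one]
  exact_mod_cast h

section
variable {ι : Type*} [Fintype ι] [DecidableEq ι]

lemma card_filter_dvd_simplexPoints {w : ι → ℝ} (hw : ∀ i, 0 < w i) (T : ℝ) {d : ι → ℕ}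
    (hd : ∀ i, 0 < d i) :
    ((simplexPoints w T).filter fun a => ∀ i, d i ∣ a i).card =
      (simplexPoints (fun i => w i * d i) T).card := by
  have hwd : ∀ i, 0 < w i * (d i : ℝ) := fun i => mul_pos (hw i) (by exact_mod_cast hd i)
  symm
  refine Finset.card_bij (fun c _ i => d i * c i) ?_ ?_ ?_
  · intro c hc
    rw [mem_simplexPoints hwd] at hc
    rw [Finset.mem_filter, mem_simplexPoints hw]
    refine ⟨⟨fun i => mul_pos (hd i) (hc.1 i), ?_⟩, fun i => dvd_mul_right _ _⟩
    simpa [mul_assoc] using hc.2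
  · intro c _ c' _ h
    ext i
    exact Nat.eq_of_mul_eq_mul_left (hd i) (congrFun h i)
  · intro a ha
    rw [Finset.mem_filter, mem_simplexPoints hw] at ha
    choose c hc using ha.2
    refine ⟨c, ?_, funext fun i => (hc i).symm⟩
    rw [mem_simplexPoints hwd]
    refine ⟨fun i => Nat.pos_of_mul_pos_left (a := d i) (by rw [← hc i]; exact ha.1.1 i), ?_⟩
    simpa [mul_assoc, hc] using ha.1.2

lemma card_coprime_simplexPoints
    [DecidablePred fun ab : (ι → ℕ) × (ι → ℕ) => ∀ i, Nat.Coprime (ab.1 i) (ab.2 i)]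
    {w : ι → ℝ} (hw : ∀ i, 0 < w i) (T : ℝ) :
    (((simplexPoints w T ×ˢ simplexPoints w T).filter
        fun ab => ∀ i, Nat.Coprime (ab.1 i) (ab.2 i)).card : ℝ) =
      ∑' d : ι → ℕ, (∏ i, (ArithmeticFunction.moebius (d i) : ℝ)) *
        ((simplexPoints (fun i => w i * d i) T).card : ℝ) ^ 2 := by
  set S := simplexPoints w T with hS
  obtain ⟨M, hM⟩ : ∃ M, ∀ a ∈ S, ∀ i, a i ≤ M :=
    ⟨S.sup fun a => Finset.univ.sup a, fun a ha i =>
      (Finset.le_sup (f := a) (Finset.mem_univ i)).trans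
        (Finset.le_sup (f := fun a : ι → ℕ => Finset.univ.sup a) ha)⟩
  have hpos : ∀ a ∈ S, ∀ i, 0 < a i := fun a ha => ((mem_simplexPoints hw).1 ha).1
  rw [tsum_eq_sum (s := Fintype.piFinset fun _ => Finset.Icc 1 M)]
  · calc (((S ×ˢ S).filter fun ab => ∀ i, Nat.Coprime (ab.1 i) (ab.2 i)).card : ℝ)
        = ∑ ab ∈ S ×ˢ S, ∏ i, (if Nat.Coprime (ab.1 i) (ab.2 i) then (1 : ℝ) else 0) := by
          rw [Finset.card_filter]
          push_cast
          refine Finset.sum_congr rfl fun ab _ => ?_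
          rw [Finset.prod_ite_zero]
          simp
      _ = ∑ ab ∈ S ×ˢ S, ∏ i, ∑ d ∈ Finset.Icc 1 M, (if d ∣ ab.1 i ∧ d ∣ ab.2 i then
            (ArithmeticFunction.moebius d : ℝ) else 0) := by
          refine Finset.sum_congr rfl fun ab hab => Finset.prod_congr rfl fun i _ => ?_
          have ha := (Finset.mem_product.1 hab).1
          rw [sum_moebius_common_divisors (hpos _ ha i) (hM _ ha i)]
      _ = ∑ ab ∈ S ×ˢ S, ∑ d ∈ Fintype.piFinset fun _ : ι => Finset.Icc 1 M,
            ∏ i, (if d i ∣ ab.1 i ∧ d i ∣ ab.2 i then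
              (ArithmeticFunction.moebius (d i) : ℝ) else 0) := by
          refine Finset.sum_congr rfl fun ab _ => ?_
          rw [Finset.prod_univ_sum]
      _ = _ := by
          rw [Finset.sum_comm]
          refine Finset.sum_congr rfl fun d hd => ?_
          have hd' : ∀ i, 0 < d i := fun i =>
            (Finset.mem_Icc.1 (Fintype.mem_piFinset.1 hd i)).1
          rw [← card_filter_dvd_simplexPoints hw T hd', ← hS, sq, ← Nat.cast_mul,
            ← Finset.card_product, ← Finset.filter_product, Finset.card_filter, Nat.cast_sum,
            Finset.mul_sum]
          refine Finset.sum_congr rfl fun ab _ => ?_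
          rw [Finset.prod_ite_zero]
          simp [forall_and]
  · intro d hd
    by_cases hd0 : ∃ i, d i = 0
    · obtain ⟨i, hi⟩ := hd0
      rw [Finset.prod_eq_zero (Finset.mem_univ i) (by simp [hi]), zero_mul]
    · push Not at hd0
      have hd' : ∀ i, 0 < d i := fun i => Nat.pos_of_ne_zero (hd0 i)
      rw [← card_filter_dvd_simplexPoints hw T hd', Finset.filter_false_of_mem, Finset.card_empty]
      · simp
      · intro a ha hdvd
        refine hd (Fintype.mem_piFinset.2 fun i => Finset.mem_Icc.2 ⟨hd' i, ?_⟩)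
        exact (Nat.le_of_dvd (hpos a ha i) (hdvd i)).trans (hM a ha i)

end

lemma tendsto_card_coprime_simplexPoints {r : ℕ} {w : Fin r → ℝ} (hw : ∀ i, 0 < w i) :
    Tendsto (fun T : ℝ => (((simplexPoints w T ×ˢ simplexPoints w T).filter
        fun ab => ∀ i, Nat.Coprime (ab.1 i) (ab.2 i)).card : ℝ) /
          ((simplexPoints w T).card : ℝ) ^ 2) atTop (nhds (((Real.pi ^ 2 / 6) ^ r)⁻¹)) := by
  set V := MeasureTheory.volume.real (weightedSimplex w) with hV
  have hVpos : 0 < V := volume_weightedSimplex_pos hw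
  have hden := tendsto_card_simplexPoints hw
  rw [← hV, Fintype.card_fin] at hden
  have hlim : HasSum (fun d : Fin r → ℕ => (∏ i, (ArithmeticFunction.moebius (d i) : ℝ)) *
      ((∏ i, (d i : ℝ))⁻¹ * V) ^ 2) (((Real.pi ^ 2 / 6) ^ r)⁻¹ * V ^ 2) := by
    have := (hasSum_prod_pi hasSum_moebius_div_sq r).mul_right (V ^ 2)
    rw [inv_pow] at this
    refine this.congr_fun fun d => ?_
    rw [Finset.prod_div_distrib, Finset.prod_pow]
    ring
  have hnum : Tendsto (fun T : ℝ => ∑' d : Fin r → ℕ,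
      (∏ i, (ArithmeticFunction.moebius (d i) : ℝ)) *
        (((simplexPoints (fun i => w i * d i) T).card : ℝ) / T ^ r) ^ 2) atTop
      (nhds (((Real.pi ^ 2 / 6) ^ r)⁻¹ * V ^ 2)) := by
    rw [← hlim.tsum_eq]
    have hbound : Summable fun d : Fin r → ℕ =>
        ((∏ i, w i)⁻¹) ^ 2 * ∏ i, (1 / (d i : ℝ) ^ 2) :=
      (hasSum_prod_pi hasSum_zeta_two r).summable.mul_left _
    refine tendsto_tsum_of_dominated_convergence hbound (fun d => ?_) ?_
    · by_cases hd0 : ∃ i, d i = 0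
      · obtain ⟨i, hi⟩ := hd0
        have : ∏ i, (ArithmeticFunction.moebius (d i) : ℝ) = 0 :=
          Finset.prod_eq_zero (Finset.mem_univ i) (by simp [hi])
        simp [this]
      · push Not at hd0
        have hd : ∀ i, 0 < (d i : ℝ) := fun i => by exact_mod_cast Nat.pos_of_ne_zero (hd0 i)
        have h := tendsto_card_simplexPoints fun i => mul_pos (hw i) (hd i)
        rw [volume_weightedSimplex_mul hd, Fintype.card_fin] at h
        exact (h.pow 2).const_mul _
    · filter_upwards [eventually_gt_atTop 0] with T hT d
      by_cases hd0 : ∃ i, d i = 0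
      · obtain ⟨i, hi⟩ := hd0
        have : ∏ i, (ArithmeticFunction.moebius (d i) : ℝ) = 0 :=
          Finset.prod_eq_zero (Finset.mem_univ i) (by simp [hi])
        rw [this, zero_mul, norm_zero]
        positivity
      · push Not at hd0
        have hd : ∀ i, 0 < (d i : ℝ) := fun i => by exact_mod_cast Nat.pos_of_ne_zero (hd0 i)
        have hμ : ‖∏ i, (ArithmeticFunction.moebius (d i) : ℝ)‖ ≤ 1 := by
          rw [norm_prod]
          refine Finset.prod_le_one (fun i _ => norm_nonneg _) fun i _ => ?_
          rw [Real.norm_eq_abs]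
          exact_mod_cast ArithmeticFunction.abs_moebius_le_one
        have hc : ((simplexPoints (fun i => w i * d i) T).card : ℝ) / T ^ r ≤
            (∏ i, w i)⁻¹ * (∏ i, (d i : ℝ))⁻¹ := by
          rw [div_le_iff₀ (by positivity)]
          refine (card_simplexPoints_le (fun i => mul_pos (hw i) (hd i)) hT.le).trans_eq ?_
          rw [Finset.prod_div_distrib, Finset.prod_mul_distrib, Finset.prod_const,
            Finset.card_univ, Fintype.card_fin, div_eq_mul_inv, mul_inv, mul_comm]
        rw [norm_mul, norm_pow, Real.norm_of_nonneg (by positivity :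
          0 ≤ ((simplexPoints (fun i => w i * d i) T).card : ℝ) / T ^ r)]
        calc _ ≤ 1 * ((∏ i, w i)⁻¹ * (∏ i, (d i : ℝ))⁻¹) ^ 2 := by gcongr
          _ = _ := by
            rw [one_mul, mul_pow, Finset.prod_div_distrib, Finset.prod_pow]
            simp
  have hquot := hnum.div (hden.pow 2) (by positivity)
  rw [mul_div_cancel_right₀ _ (by positivity)] at hquot
  refine hquot.congr' ?_
  filter_upwards [eventually_gt_atTop 0] with T hT
  rw [card_coprime_simplexPoints hw]
  simp only [Pi.div_apply, div_pow, ← mul_div_assoc]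
  rw [tsum_div_const, div_div_div_cancel_right₀ (by positivity)]

section
variable {r : ℕ} {p : Fin r → ℕ}

lemma factorization_prod_primes_pow (hp : ∀ i, (p i).Prime) (hinj : Function.Injective p)
    (a : Fin r → ℕ) (i : Fin r) : (∏ j, p j ^ a j).factorization (p i) = a i := by
  rw [Nat.factorization_prod_apply fun j _ => pow_ne_zero _ (hp j).ne_zero]
  rw [Finset.sum_eq_single i]
  · simp [(hp i).factorization]
  · intro j _ hj
    rw [(hp j).factorization_pow]
    exact Finsupp.single_eq_of_ne (hinj.ne hj).symm
  · simp

lemma injective_prod_primes_pow (hp : ∀ i, (p i).Prime) (hinj : Function.Injective p) :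
    Function.Injective fun a : Fin r → ℕ => ∏ j, p j ^ a j := fun a b h => by
  ext i
  rw [← factorization_prod_primes_pow hp hinj a i, ← factorization_prod_primes_pow hp hinj b i]
  exact congrArg (fun n : ℕ => n.factorization (p i)) h

lemma setOf_primeFactors_eq_image (hr : 1 ≤ r) (hp : ∀ i, (p i).Prime)
    (hinj : Function.Injective p) {x : ℝ} (hx : 0 < x) :
    {n : ℕ | (n : ℝ) ≤ x ∧ n.primeFactors = Finset.image p Finset.univ} =
      (fun a : Fin r → ℕ => ∏ j, p j ^ a j) ''
        (simplexPoints (fun i => Real.log (p i)) (Real.log x) : Set (Fin r → ℕ)) := by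
  have hw : ∀ i, 0 < Real.log (p i) := fun i =>
    Real.log_pos (by exact_mod_cast (hp i).one_lt)
  have hle : ∀ a : Fin r → ℕ, ((∏ j, p j ^ a j : ℕ) : ℝ) ≤ x ↔
      ∑ i, Real.log (p i) * a i ≤ Real.log x := fun a => by
    have hpos : ∀ j, 0 < (p j : ℝ) := fun j => by exact_mod_cast (hp j).pos
    rw [← Real.log_le_log_iff (by exact_mod_cast Finset.prod_pos fun j _ => pow_pos (hp j).pos _) hx]
    push_cast
    rw [Real.log_prod fun j _ => (pow_pos (hpos j) _).ne']
    simp only [Real.log_pow, mul_comm]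
  ext n
  simp only [Set.mem_ofPred_eq, Set.mem_image, SetLike.mem_coe, mem_simplexPoints hw]
  constructor
  · rintro ⟨hn, hpf⟩
    have hn0 : n ≠ 0 := by
      rintro rfl
      have : p ⟨0, hr⟩ ∈ Finset.image p Finset.univ :=
        Finset.mem_image_of_mem _ (Finset.mem_univ _)
      rw [← hpf] at this
      simp at this
    have hprod : ∏ j, p j ^ n.factorization (p j) = n := by
      conv_rhs => rw [← Nat.prod_factorization_pow_eq_self hn0]
      rw [Finsupp.prod, Nat.support_factorization, hpf, Finset.prod_image hinj.injOn]
    refine ⟨fun i => n.factorization (p i), ⟨fun i => ?_, ?_⟩, hprod⟩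
    · have : p i ∈ n.primeFactors := by
        rw [hpf]
        exact Finset.mem_image_of_mem _ (Finset.mem_univ _)
      exact (hp i).factorization_pos_of_dvd hn0 (Nat.dvd_of_mem_primeFactors this)
    · rw [← hle, hprod]
      exact hn
  · rintro ⟨a, ⟨ha0, ha⟩, rfl⟩
    refine ⟨(hle a).2 ha, ?_⟩
    ext q
    simp only [Nat.mem_primeFactors, Finset.mem_image, Finset.mem_univ, true_and]
    constructor
    · rintro ⟨hq, hdvd, -⟩
      obtain ⟨j, -, hj⟩ := (hq.prime.dvd_finsetProd_iff _).1 hdvd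
      exact ⟨j, ((Nat.prime_dvd_prime_iff_eq hq (hp j)).1 (hq.dvd_of_dvd_pow hj)).symm⟩
    · rintro ⟨i, rfl⟩
      exact ⟨hp i, (dvd_pow_self _ (ha0 i).ne').trans (Finset.dvd_prod_of_mem _ (Finset.mem_univ i)),
        Finset.prod_ne_zero_iff.2 fun j _ => pow_ne_zero _ (hp j).ne_zero⟩

lemma expCoprime_iff (hr : 1 ≤ r) {n m : ℕ}
    (hn : n.primeFactors = Finset.image p Finset.univ)
    (hm : m.primeFactors = Finset.image p Finset.univ) :
    ExpCoprime n m ↔ ∀ i, Nat.Coprime (n.factorization (p i)) (m.factorization (p i)) := by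
  have h1 : ∀ {k : ℕ}, k.primeFactors = Finset.image p Finset.univ → 1 < k := fun {k} hk => by
    rw [← Nat.nonempty_primeFactors, hk]
    exact ⟨p ⟨0, hr⟩, Finset.mem_image_of_mem _ (Finset.mem_univ _)⟩
  have := h1 hn
  have := h1 hm
  simp only [ExpCoprime, hn, hm]
  simp [*, this.ne', (h1 hn).ne']

end

/-- **Corollary 2.** For fixed `r ≥ 1` and fixed distinct primes `p 1, ..., p r`, the
asymptotic density of pairs of exponentially coprime integers having prime divisors
exactly `p_1, ..., p_r` is `ζ(2)^{-r}`; that is, with `N(p_1,...,p_r;x)` the number of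
`n ≤ x` with `κ(n) = p_1 ⋯ p_r` and `P^{(e)}(p_1,...,p_r;x)` the number of pairs
`⟨n,m⟩` of exponentially coprime integers with `κ(n) = κ(m) = p_1 ⋯ p_r`, `n, m ≤ x`,
one has `lim_{x→∞} P^{(e)}(p_1,...,p_r;x) · (N(p_1,...,p_r;x))⁻² = ζ(2)^{-r}`,
where `ζ(2) = π²/6`. -/
theorem expCoprime_pairs_density
    (r : ℕ) (hr : 1 ≤ r) (p : Fin r → ℕ)
    (hp : ∀ i, (p i).Prime) (hinj : Function.Injective p) :
    Tendsto
      (fun x : ℝ =>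
        (Set.ncard {nm : ℕ × ℕ | (nm.1 : ℝ) ≤ x ∧ (nm.2 : ℝ) ≤ x ∧
            ExpCoprime nm.1 nm.2 ∧
            nm.1.primeFactors = Finset.image p Finset.univ ∧
            nm.2.primeFactors = Finset.image p Finset.univ} : ℝ) /
          (Set.ncard {n : ℕ | (n : ℝ) ≤ x ∧
            n.primeFactors = Finset.image p Finset.univ} : ℝ) ^ 2)
      atTop (nhds (((Real.pi ^ 2 / 6) ^ r)⁻¹)) := by
  refine ((tendsto_card_coprime_simplexPoints (w := fun i => Real.log (p i)) fun i =>
    Real.log_pos (by exact_mod_cast (hp i).one_lt)).comp Real.tendsto_log_atTop).congr' ?_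
  filter_upwards [eventually_gt_atTop 0] with x hx
  have himage := setOf_primeFactors_eq_image hr hp hinj hx
  have hφ := injective_prod_primes_pow hp hinj
  set S := simplexPoints (fun i => Real.log (p i)) (Real.log x) with hS
  have hpairs : {nm : ℕ × ℕ | (nm.1 : ℝ) ≤ x ∧ (nm.2 : ℝ) ≤ x ∧ ExpCoprime nm.1 nm.2 ∧
      nm.1.primeFactors = Finset.image p Finset.univ ∧
      nm.2.primeFactors = Finset.image p Finset.univ} =
      Prod.map (fun a : Fin r → ℕ => ∏ j, p j ^ a j) (fun a : Fin r → ℕ => ∏ j, p j ^ a j) ''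
        ((S ×ˢ S).filter fun ab => ∀ i, Nat.Coprime (ab.1 i) (ab.2 i) :
          Finset ((Fin r → ℕ) × (Fin r → ℕ))) := by
    have hmem : ∀ n : ℕ, ((n : ℝ) ≤ x ∧ n.primeFactors = Finset.image p Finset.univ) ↔
        ∃ a ∈ S, ∏ j, p j ^ a j = n := fun n => by
      simpa using Set.ext_iff.1 himage n
    ext ⟨n, m⟩
    simp only [Set.mem_ofPred_eq, Set.mem_image, Finset.coe_filter, Finset.mem_product,
      Prod.exists, Prod.map_apply, Prod.mk.injEq]
    constructor
    · rintro ⟨hn, hm, hc, hn', hm'⟩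
      rw [expCoprime_iff hr hn' hm'] at hc
      obtain ⟨a, ha, rfl⟩ := (hmem n).1 ⟨hn, hn'⟩
      obtain ⟨b, hb, rfl⟩ := (hmem m).1 ⟨hm, hm'⟩
      simp only [factorization_prod_primes_pow hp hinj] at hc
      exact ⟨a, b, ⟨⟨ha, hb⟩, hc⟩, rfl, rfl⟩
    · rintro ⟨a, b, ⟨⟨ha, hb⟩, hc⟩, rfl, rfl⟩
      obtain ⟨hn, hn'⟩ := (hmem _).2 ⟨a, ha, rfl⟩
      obtain ⟨hm, hm'⟩ := (hmem _).2 ⟨b, hb, rfl⟩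
      refine ⟨hn, hm, ?_, hn', hm'⟩
      rw [expCoprime_iff hr hn' hm']
      simpa only [factorization_prod_primes_pow hp hinj] using hc
  rw [hpairs, himage, Set.ncard_image_of_injective _ (hφ.prodMap hφ),
    Set.ncard_image_of_injective _ hφ, Set.ncard_coe_finset, Set.ncard_coe_finset]
  rfl
end
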